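/- arXiv:math/0211156 — 4 statements merged into one kernel-verified Lean document; each statement's English description precedes it below -/
import Mathlib

section
/- Let R be a semisimple ring, e ∈ R a primitive idempotent, and ẽ ∈ R an idempotent with e·ẽ ≠ e. Then there exists x ∈ R such that e·(1−ẽ)·x·e = e, and for any such x the element f := (1−ẽ)·x·e is an idempotent which generates the same left ideal as e, i.e., R·f = R·e, and satisfies ẽ·f = 0. -/
/-- Semisimple rings are von Neumann regular. -/
theorem IsSemisimpleRing.exists_mul_mul_eq_self {R : Type*} [Ring R] [IsSemisimpleRing R] (a : R) :
    ∃ c : R, a * c * a = a := by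
  obtain ⟨g, hg, hspan⟩ := IsSemisimpleRing.ideal_eq_span_idempotent (Ideal.span {a})
  obtain ⟨c, hc⟩ := Ideal.mem_span_singleton'.1 (hspan ▸ Ideal.mem_span_singleton_self g)
  obtain ⟨d, hd⟩ := Ideal.mem_span_singleton'.1 (hspan ▸ Ideal.mem_span_singleton_self a)
  refine ⟨c, ?_⟩
  rw [mul_assoc, hc, ← hd, mul_assoc, hg.eq]

/-- A nonzero element of a minimal left ideal generates it. -/
theorem Ideal.span_singleton_eq_of_isSimpleModule {R : Type*} [Ring R] {I : Ideal R}
    (hI : IsSimpleModule R I) {b : R} (hb : b ∈ I) (hb0 : b ≠ 0) : Ideal.span {b} = I :=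
  ((isSimpleModule_iff_isAtom.1 hI).le_iff_eq (by simpa using hb0)).1
    ((Ideal.span_singleton_le_iff_mem I).2 hb)

theorem stmt_6 {R : Type*} [Ring R] [IsSemisimpleRing R]
    (e et : R) (he : IsIdempotentElem e)
    (hprim : IsSimpleModule R (Ideal.span {e} : Ideal R))
    (het : IsIdempotentElem et) (hne : e * et ≠ e) :
    (∃ x : R, e * (1 - et) * x * e = e) ∧
    ∀ x : R, e * (1 - et) * x * e = e →
      IsIdempotentElem ((1 - et) * x * e) ∧
      Ideal.span {(1 - et) * x * e} = (Ideal.span {e} : Ideal R) ∧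
      et * ((1 - et) * x * e) = 0 := by
  constructor
  · obtain ⟨c, hc⟩ := IsSemisimpleRing.exists_mul_mul_eq_self (e * (1 - et))
    have ha0 : e * (1 - et) ≠ 0 := by
      rw [mul_sub, mul_one, sub_ne_zero]
      exact hne.symm
    have hea : e * (e * (1 - et)) = e * (1 - et) := by rw [← mul_assoc, he.eq]
    generalize e * (1 - et) = a at hc ha0 hea ⊢
    have hidem : a * c * e * (a * c * e) = a * c * e := by
      calc a * c * e * (a * c * e) = a * c * (e * a) * c * e := by simp only [mul_assoc]
        _ = a * c * e := by rw [hea, hc]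
    have hne0 : a * c * e ≠ 0 := fun h0 ↦ ha0 <| by
      rw [← hc]
      nth_rewrite 2 [← hea]
      rw [← mul_assoc, h0, zero_mul]
    have hspan := Ideal.span_singleton_eq_of_isSimpleModule hprim
      (Ideal.mem_span_singleton'.2 ⟨a * c, rfl⟩) hne0
    obtain ⟨r, hr⟩ := Ideal.mem_span_singleton'.1 (hspan ▸ Ideal.mem_span_singleton_self e)
    refine ⟨c, ?_⟩
    calc a * c * e = e * (a * c * e) := by simp only [← mul_assoc, hea]
      _ = r * (a * c * e) * (a * c * e) := by rw [hr]
      _ = e := by rw [mul_assoc, hidem, hr]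
  · intro x hx
    have hef : e * ((1 - et) * x * e) = e := by simpa only [mul_assoc] using hx
    refine ⟨?_, le_antisymm ?_ ?_, ?_⟩
    · change (1 - et) * x * e * ((1 - et) * x * e) = (1 - et) * x * e
      rw [mul_assoc _ e, hef]
    · exact (Ideal.span_singleton_le_iff_mem _).2 (Ideal.mem_span_singleton'.2 ⟨_, rfl⟩)
    · exact (Ideal.span_singleton_le_iff_mem _).2 (Ideal.mem_span_singleton'.2 ⟨_, hef⟩)
    · rw [← mul_assoc, ← mul_assoc, het.mul_one_sub_self, zero_mul, zero_mul]
end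

section
/- Let R be a semisimple ring, e ∈ R a primitive idempotent, and ẽ ∈ R an idempotent with e·ẽ ≠ e. Let f ∈ R be an idempotent with R·f = R·e and ẽ·f = 0. Then there exists x̃ ∈ R such that f·(1−ẽ)·x̃·f = f, and for any such x̃ the element f̃ := ẽ − (1−ẽ)·x̃·f·ẽ is an idempotent which generates the left ideal R·ẽ, i.e., R·f̃ = R·ẽ, and satisfies f·f̃ = f̃·f = 0. -/
/-- A semisimple ring is von Neumann regular. -/
theorem IsSemisimpleRing.exists_mul_mul_self {R : Type*} [Ring R] [IsSemisimpleRing R] (y : R) :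
    ∃ z : R, y * z * y = y := by
  obtain ⟨g, hg, h⟩ := IsSemisimpleRing.ideal_eq_span_idempotent (Ideal.span {y})
  obtain ⟨z, rfl⟩ : ∃ z, z * y = g :=
    Ideal.mem_span_singleton'.1 (h ▸ Ideal.mem_span_singleton_self g)
  obtain ⟨a, ha⟩ : ∃ a, a * (z * y) = y :=
    Ideal.mem_span_singleton'.1 (h ▸ Ideal.mem_span_singleton_self y)
  refine ⟨z, ?_⟩
  calc y * z * y = a * (z * y) * (z * y) := by rw [ha, mul_assoc]
    _ = y := by rw [mul_assoc, hg.eq, ha]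

/-- If `R f` is a minimal left ideal with `f` idempotent, nonzero elements of the corner `f R f`
have left inverses there. -/
theorem IsIdempotentElem.exists_corner_mul_eq {R : Type*} [Ring R] {f : R}
    (hf : IsIdempotentElem f) (hs : IsSimpleModule R (Ideal.span {f} : Ideal R))
    {w : R} (hw : w ≠ 0) (hfw : f * w = w) (hwf : w * f = w) :
    ∃ r : R, f * r * f * w = f := by
  have hle : (Ideal.span {w} : Ideal R) ≤ Ideal.span {f} := by
    rw [Ideal.span_singleton_le_iff_mem]
    exact Ideal.mem_span_singleton'.2 ⟨w, hwf⟩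
  have heq : (Ideal.span {w} : Ideal R) = Ideal.span {f} :=
    ((isSimpleModule_iff_isAtom.1 hs).le_iff.1 hle).resolve_left
      fun h => hw (Ideal.span_singleton_eq_bot.1 h)
  obtain ⟨r, hr⟩ : ∃ r, r * w = f :=
    Ideal.mem_span_singleton'.1 (heq ▸ Ideal.mem_span_singleton_self f)
  exact ⟨r, by rw [mul_assoc _ f, hfw, mul_assoc, hr, hf.eq]⟩

/-- If `R f` is a minimal left ideal with `f` idempotent, nonzero elements of the corner `f R f`
have right inverses there. -/
theorem IsIdempotentElem.exists_mul_corner_eq {R : Type*} [Ring R] {f : R}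
    (hf : IsIdempotentElem f) (hs : IsSimpleModule R (Ideal.span {f} : Ideal R))
    {w : R} (hw : w ≠ 0) (hfw : f * w = w) (hwf : w * f = w) :
    ∃ r : R, w * (f * r * f) = f := by
  obtain ⟨r, hr⟩ := hf.exists_corner_mul_eq hs hw hfw hwf
  have hu : f * r * f ≠ 0 := by
    intro h
    rw [h, zero_mul] at hr
    exact hw (by rw [← hfw, ← hr, zero_mul])
  obtain ⟨s, hsr⟩ := hf.exists_corner_mul_eq hs hu (by simp only [← mul_assoc, hf.eq])
    (by rw [mul_assoc, hf.eq])
  have hsw : f * s * f = w := by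
    calc f * s * f = f * s * f * f := by rw [mul_assoc _ f f, hf.eq]
      _ = f * s * f * (f * r * f) * w := by rw [mul_assoc _ (f * r * f), hr]
      _ = w := by rw [hsr, hfw]
  exact ⟨r, hsw ▸ hsr⟩

theorem stmt_7 {R : Type*} [Ring R] [IsSemisimpleRing R]
    (e et f : R) (he : IsIdempotentElem e)
    (hprim : IsSimpleModule R (Ideal.span {e} : Ideal R))
    (het : IsIdempotentElem et) (hne : e * et ≠ e)
    (hf : IsIdempotentElem f) (hfe : Ideal.span {f} = (Ideal.span {e} : Ideal R))
    (hetf : et * f = 0) :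
    (∃ xt : R, f * (1 - et) * xt * f = f) ∧
    ∀ xt : R, f * (1 - et) * xt * f = f →
      IsIdempotentElem (et - (1 - et) * xt * f * et) ∧
      Ideal.span {et - (1 - et) * xt * f * et} = (Ideal.span {et} : Ideal R) ∧
      f * (et - (1 - et) * xt * f * et) = 0 ∧
      (et - (1 - et) * xt * f * et) * f = 0 := by
  refine ⟨?_, fun x hx => ?_⟩
  · rw [← hfe] at hprim
    have hy : f * (1 - et) ≠ 0 := by
      intro h
      rw [mul_sub, mul_one, sub_eq_zero] at h
      obtain ⟨a, rfl⟩ : ∃ a, a * f = e :=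
        Ideal.mem_span_singleton'.1 (hfe ▸ Ideal.mem_span_singleton_self e)
      exact hne (by rw [mul_assoc, ← h])
    obtain ⟨z, hz⟩ := IsSemisimpleRing.exists_mul_mul_self (f * (1 - et))
    have hw : f * (1 - et) * z * f ≠ 0 := by
      intro h
      rw [← mul_assoc, h, zero_mul] at hz
      exact hy hz.symm
    obtain ⟨r, hr⟩ := hf.exists_mul_corner_eq hprim hw (by simp only [← mul_assoc, hf.eq])
      (by rw [mul_assoc, hf.eq])
    refine ⟨z * f * f * r, ?_⟩
    simpa only [mul_assoc] using hr
  · have hp : et * (1 - et) = 0 := by rw [mul_sub, mul_one, het.eq, sub_self]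
    have hleft : et * (et - (1 - et) * x * f * et) = et := by
      rw [mul_sub, het.eq]
      simp only [← mul_assoc, hp, zero_mul, sub_zero]
    have hright : (1 - (1 - et) * x * f) * et = et - (1 - et) * x * f * et := by
      rw [sub_mul, one_mul]
    refine ⟨?_, le_antisymm ?_ ?_, ?_, ?_⟩
    · rw [IsIdempotentElem]
      nth_rewrite 1 [← hright]
      rw [mul_assoc, hleft, hright]
    · rw [Ideal.span_singleton_le_iff_mem]
      exact Ideal.mem_span_singleton'.2 ⟨_, hright⟩
    · rw [Ideal.span_singleton_le_iff_mem]
      exact Ideal.mem_span_singleton'.2 ⟨_, hleft⟩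
    · rw [mul_sub]
      simp only [← mul_assoc, hx, sub_self]
    · rw [← hright, mul_assoc, hetf, mul_zero]
end

section
/- Let R be a semisimple ring and e_1,…,e_h ∈ R idempotents. Then the right annihilator of the left ideal 𝔩 := ⋂_{i=1}^h R·e_i, namely A_r(𝔩) = {x ∈ R : y·x = 0 for all y ∈ 𝔩}, equals the right ideal Σ_{i=1}^h (1−e_i)·R. Moreover, if e ∈ R is an idempotent with e·R = Σ_{i=1}^h (1−e_i)·R, then 1−e is a generating idempotent of 𝔩, i.e., ⋂_{i=1}^h R·e_i = R·(1−e). -/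
theorem IsIdempotentElem.mem_span_singleton_iff {R : Type*} [Ring R] {e : R}
    (he : IsIdempotentElem e) (y : R) : y ∈ Ideal.span {e} ↔ y * (1 - e) = 0 := by
  rw [Ideal.mem_span_singleton']
  constructor
  · rintro ⟨a, rfl⟩
    rw [mul_assoc, mul_sub, mul_one, he.eq, sub_self, mul_zero]
  · intro hy
    exact ⟨y, by rw [mul_sub, mul_one, sub_eq_zero] at hy; exact hy.symm⟩

theorem iInf_span_singleton_eq_of_idempotent {R ι : Type*} [Ring R] [Fintype ι]
    {e : ι → R} (he : ∀ i, IsIdempotentElem (e i)) {f : R} (hf : IsIdempotentElem f)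
    (hfe : {x : R | ∃ c : R, x = f * c} = {x : R | ∃ c : ι → R, x = ∑ i, (1 - e i) * c i}) :
    (⨅ i, Ideal.span {e i} : Ideal R) = Ideal.span {1 - f} := by
  classical
  ext y
  simp only [Submodule.mem_iInf, (he _).mem_span_singleton_iff,
    hf.one_sub.mem_span_singleton_iff, sub_sub_cancel]
  constructor
  · intro hy
    obtain ⟨c, hc⟩ := hfe.subset ⟨1, (mul_one f).symm⟩
    rw [hc, Finset.mul_sum]
    exact Finset.sum_eq_zero fun i _ ↦ by rw [← mul_assoc, hy, zero_mul]
  · intro hy i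
    obtain ⟨c, hc⟩ := (Set.ext_iff.mp hfe (1 - e i)).mpr ⟨Pi.single i 1, by simp [Pi.single_apply]⟩
    rw [hc, ← mul_assoc, hy, zero_mul]

theorem IsSemisimpleRing.exists_idempotent_mul_eq_sum {R ι : Type*} [Ring R]
    [IsSemisimpleRing R] [Fintype ι] (a : ι → R) :
    ∃ f : R, IsIdempotentElem f ∧
      {x : R | ∃ c : R, x = f * c} = {x : R | ∃ c : ι → R, x = ∑ i, a i * c i} := by
  obtain ⟨g, hg, hspan⟩ := IsSemisimpleRing.ideal_eq_span_idempotent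
    (Ideal.span (Set.range fun i ↦ MulOpposite.op (a i)))
  refine ⟨g.unop, congrArg MulOpposite.unop hg, ?_⟩
  ext x
  have hmem := SetLike.ext_iff.mp hspan (MulOpposite.op x)
  rw [Ideal.mem_span_singleton', Ideal.mem_span_range_iff_exists_fun] at hmem
  constructor
  · rintro ⟨c, rfl⟩
    obtain ⟨d, hd⟩ := hmem.mpr ⟨MulOpposite.op c, rfl⟩
    exact ⟨fun i ↦ (d i).unop, by simpa using (congrArg MulOpposite.unop hd).symm⟩
  · rintro ⟨c, rfl⟩
    obtain ⟨d, hd⟩ := hmem.mp ⟨fun i ↦ MulOpposite.op (c i), by simp⟩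
    exact ⟨d.unop, by simpa using (congrArg MulOpposite.unop hd).symm⟩

theorem stmt_9 {R : Type*} [Ring R] [IsSemisimpleRing R] {h : ℕ} (hh : 1 ≤ h)
    (e : Fin h → R) (he : ∀ i, IsIdempotentElem (e i)) :
    ({x : R | ∀ y ∈ (⨅ i, Ideal.span {e i} : Ideal R), y * x = 0} =
      {x : R | ∃ c : Fin h → R, x = ∑ i, (1 - e i) * c i}) ∧
    ∀ f : R, IsIdempotentElem f →
      {x : R | ∃ c : R, x = f * c} = {x : R | ∃ c : Fin h → R, x = ∑ i, (1 - e i) * c i} →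
      (⨅ i, Ideal.span {e i} : Ideal R) = Ideal.span {1 - f} := by
  refine ⟨?_, fun f hf hfe ↦ iInf_span_singleton_eq_of_idempotent he hf hfe⟩
  obtain ⟨f, hf, hfe⟩ := IsSemisimpleRing.exists_idempotent_mul_eq_sum fun i ↦ 1 - e i
  rw [iInf_span_singleton_eq_of_idempotent he hf hfe, ← hfe]
  ext x
  constructor
  · intro hx
    have := hx (1 - f) (Ideal.mem_span_singleton_self _)
    rw [sub_mul, one_mul, sub_eq_zero] at this
    exact ⟨x, this⟩
  · rintro ⟨c, rfl⟩ y hy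
    rw [hf.one_sub.mem_span_singleton_iff, sub_sub_cancel] at hy
    rw [← mul_assoc, hy, zero_mul]
end

section
/- Let K be a field, n ≥ 1, and A ∈ M_n(K), A ≠ 0, such that 𝔩 := M_n(K)·A is a minimal left ideal of the matrix ring M_n(K). Let a ∈ K^n be a nonzero row of A and B = [b_{ij}] ∈ M_n(K), B ≠ 0. Let S ⊆ {1,…,n} be a set of indices such that the linear map sending each solution λ ∈ K^n of the system Σ_{j=1}^n b_{ij}λ_j = 0 (i = 1,…,n) to its tuple of coordinates (λ_i)_{i∉S} is a bijection from the solution space onto K^{{1,…,n}∖S} (i.e., the complement of S indexes the free parameters of a parametric form of the solution). Then the set { B·C_{i,a} : i ∈ S } is a basis of the K-vector space B·𝔩 = B·M_n(K)·A. -/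
/-- `rowMatrix i a` is the matrix `C_{i,a}` whose `i`-th row equals the row vector `a`
and all of whose other rows are zero. -/
def rowMatrix {K : Type*} [Semiring K] {n : ℕ} (i : Fin n) (a : Fin n → K) :
    Matrix (Fin n) (Fin n) K :=
  Matrix.of fun j k => if j = i then a k else 0

open Matrix in
theorem rowMatrix_eq_vecMulVec {K : Type*} [Semiring K] {n : ℕ} (i : Fin n) (a : Fin n → K) :
    rowMatrix i a = vecMulVec (Pi.single i 1) a := by
  ext j k
  simp [rowMatrix, vecMulVec_apply, Pi.single_apply]

open Matrix in
/-- If `R * A` is a minimal left ideal of the matrix ring `R`, then `A` is an outer product of a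
vector with any of its nonzero rows. -/
theorem exists_eq_vecMulVec_of_isSimpleModule {K : Type*} [Field K] {n : ℕ}
    {A : Matrix (Fin n) (Fin n) K}
    (hmin : IsSimpleModule (Matrix (Fin n) (Fin n) K)
      (Ideal.span {A} : Ideal (Matrix (Fin n) (Fin n) K)))
    {i : Fin n} (ha : A i ≠ 0) : ∃ u : Fin n → K, u i = 1 ∧ A = vecMulVec u (A i) := by
  have hrow : vecMulVec (Pi.single i 1) (Pi.single i 1) * A = rowMatrix i (A i) := by
    rw [vecMulVec_mul, single_one_vecMul, rowMatrix_eq_vecMulVec]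
    rfl
  have hmem : rowMatrix i (A i) ∈ Ideal.span {A} :=
    Ideal.mem_span_singleton'.2 ⟨_, hrow⟩
  have hne : rowMatrix i (A i) ≠ 0 := fun h => ha <| by
    ext k
    simpa [rowMatrix] using congrFun (congrFun h i) k
  have hatom := isSimpleModule_iff_isAtom.1 hmin
  have hle : Ideal.span {rowMatrix i (A i)} ≤ Ideal.span {A} :=
    (Ideal.span_singleton_le_iff_mem _).2 hmem
  have heq : Ideal.span {rowMatrix i (A i)} = Ideal.span {A} :=
    (hatom.le_iff.1 hle).resolve_left fun h => hne (Ideal.span_singleton_eq_bot.1 h)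
  obtain ⟨X, hX⟩ := Ideal.mem_span_singleton'.1 (heq ▸ Ideal.mem_span_singleton_self A)
  rw [rowMatrix_eq_vecMulVec, mul_vecMulVec] at hX
  refine ⟨_, ?_, hX.symm⟩
  obtain ⟨k, hk⟩ := Function.ne_iff.1 ha
  have := congrFun (congrFun hX i) k
  rw [vecMulVec_apply] at this
  exact mul_right_cancel₀ hk (this.trans (one_mul _).symm)

open Matrix in
theorem vecMulVec_eq_zero_of_ne_zero {K : Type*} [Field K] {n : ℕ} {v a : Fin n → K}
    (ha : a ≠ 0) (h : vecMulVec v a = 0) : v = 0 := by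
  obtain ⟨k, hk⟩ := Function.ne_iff.1 ha
  ext j
  have := congrFun (congrFun h j) k
  rw [vecMulVec_apply] at this
  exact (mul_eq_zero.1 this).resolve_right hk

open Matrix in
/-- A combination of the `B * rowMatrix i a` over a set `S` of indices, in terms of its
coefficient vector extended by zero. -/
theorem sum_smul_mul_rowMatrix {K : Type*} [Field K] {n : ℕ} (B : Matrix (Fin n) (Fin n) K)
    (a : Fin n → K) (S : Set (Fin n)) [Fintype S] (v : Fin n → K) (hv : ∀ i ∉ S, v i = 0) :
    ∑ i : S, v i • (B * rowMatrix (i : Fin n) a) = vecMulVec (B *ᵥ v) a := by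
  classical
  have hall : ∑ i, v i • (B * rowMatrix i a) = vecMulVec (B *ᵥ v) a := by
    ext j k
    simp only [Matrix.sum_apply, Matrix.smul_apply, smul_eq_mul, mulVec_single_one, col_apply,
      rowMatrix_eq_vecMulVec, mul_vecMulVec, vecMulVec_apply]
    simp only [mulVec, dotProduct, Finset.sum_mul]
    exact Finset.sum_congr rfl fun _ _ => by ring
  rw [← hall, ← Finset.sum_subset (Finset.subset_univ S.toFinset) fun i _ hi => by
    rw [hv i (by simpa using hi), zero_smul]]
  exact (Finset.sum_subtype S.toFinset (fun i => Set.mem_toFinset)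
    fun i => v i • (B * rowMatrix i a)).symm

theorem stmt_10 {K : Type*} [Field K] {n : ℕ} (hn : 1 ≤ n)
    (A : Matrix (Fin n) (Fin n) K) (hA : A ≠ 0)
    (hmin : IsSimpleModule (Matrix (Fin n) (Fin n) K)
      (Ideal.span {A} : Ideal (Matrix (Fin n) (Fin n) K)))
    (i0 : Fin n) (ha : A i0 ≠ 0)
    (B : Matrix (Fin n) (Fin n) K) (hB : B ≠ 0)
    (S : Set (Fin n))
    (hS : Function.Bijective
      (fun (lam : {lam : Fin n → K // ∀ i, ∑ j, B i j * lam j = 0})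
        (j : {j : Fin n // j ∉ S}) => lam.1 j.1)) :
    LinearIndependent K (fun i : S => B * rowMatrix (i : Fin n) (A i0)) ∧
    (Submodule.span K (Set.range fun i : S => B * rowMatrix (i : Fin n) (A i0)) :
        Set (Matrix (Fin n) (Fin n) K)) =
      {M : Matrix (Fin n) (Fin n) K | ∃ X, M = B * X * A} := by
  classical
  obtain ⟨u, hu, hAu⟩ := exists_eq_vecMulVec_of_isSimpleModule hmin ha
  generalize A i0 = a at ha hAu ⊢
  subst hAu
  constructor
  · rw [Fintype.linearIndependent_iff]
    intro c hc
    let v : Fin n → K := fun i => if h : i ∈ S then c ⟨i, h⟩ else 0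
    have hvS : ∀ i ∉ S, v i = 0 := fun i hi => dif_neg hi
    have hvc : ∀ i : S, v i = c i := fun i => dif_pos i.2
    have hsum := sum_smul_mul_rowMatrix B a S v hvS
    simp only [hvc, hc] at hsum
    have hBv := vecMulVec_eq_zero_of_ne_zero ha hsum.symm
    have hv := @hS.1 ⟨v, congrFun hBv⟩ ⟨0, by simp⟩ (funext fun j => hvS j j.2)
    intro i
    rw [← hvc]
    exact congrFun (congrArg Subtype.val hv) i
  · ext M
    simp only [SetLike.mem_coe, Set.mem_ofPred_eq]
    constructor
    · intro hM
      obtain ⟨c, rfl⟩ := (Submodule.mem_span_range_iff_exists_fun K).1 hM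
      refine ⟨∑ i : S, c i • Matrix.vecMulVec (Pi.single (i : Fin n) 1) (Pi.single i0 1), ?_⟩
      simp [Matrix.mul_assoc, Finset.mul_sum, Finset.sum_mul,
        rowMatrix_eq_vecMulVec, Matrix.vecMulVec_mul_vecMulVec, hu]
    · rintro ⟨X, rfl⟩
      obtain ⟨lam, hlam⟩ := hS.2 fun j => (X.mulVec u) j
      have hB : B.mulVec lam.1 = 0 := funext lam.2
      have hsum := sum_smul_mul_rowMatrix B a S (X.mulVec u - lam.1)
        fun i hi => sub_eq_zero.2 (congrFun hlam ⟨i, hi⟩).symm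
      rw [Matrix.mulVec_sub, hB, sub_zero, Matrix.mulVec_mulVec] at hsum
      rw [Matrix.mul_vecMulVec, ← hsum]
      exact Submodule.sum_mem _ fun i _ =>
        Submodule.smul_mem _ _ (Submodule.subset_span ⟨i, rfl⟩)
end
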